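/- If A and B are nonempty finite sets of integers with |A| ≥ 2 and |B| ≥ 2, then |A +̂ B| ≥ |A| + |B| - 3. -/

import Mathlib

/-- The restricted sumset of two finite sets of integers:
`A +̂ B = {a + b : a ∈ A, b ∈ B, a ≠ b}`. -/
def restrictedSumset (A B : Finset ℤ) : Finset ℤ :=
  ((A ×ˢ B).filter fun p => p.1 ≠ p.2).image fun p => p.1 + p.2

theorem mem_rs (A B : Finset ℤ) (s : ℤ) :
    s ∈ restrictedSumset A B ↔ ∃ a ∈ A, ∃ b ∈ B, a ≠ b ∧ a + b = s := by
  simp only [restrictedSumset, Finset.mem_image, Finset.mem_filter, Finset.mem_product,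
    Prod.exists]
  constructor
  · rintro ⟨a, b, ⟨⟨ha, hb⟩, hn⟩, h⟩
    exact ⟨a, ha, b, hb, hn, h⟩
  · rintro ⟨a, ha, b, hb, hn, h⟩
    exact ⟨a, b, ⟨⟨ha, hb⟩, hn⟩, h⟩

theorem rs_comm (A B : Finset ℤ) : restrictedSumset A B = restrictedSumset B A := by
  ext s
  rw [mem_rs, mem_rs]
  constructor <;>
  · rintro ⟨a, ha, b, hb, hn, h⟩
    exact ⟨b, hb, a, ha, hn.symm, by omega⟩

theorem rs_single (A B : Finset ℤ) (hA : A.card = 1) :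
    A.card + B.card ≤ (restrictedSumset A B).card + 3 := by
  obtain ⟨a, rfl⟩ := Finset.card_eq_one.1 hA
  have h1 : (B.erase a).image (fun x => a + x) ⊆ restrictedSumset {a} B := by
    intro s hs
    obtain ⟨x, hx, rfl⟩ := Finset.mem_image.1 hs
    obtain ⟨h1, h2⟩ := Finset.mem_erase.1 hx
    exact (mem_rs _ _ _).2 ⟨a, by simp, x, h2, h1.symm, rfl⟩
  have h2 := Finset.card_le_card h1
  rw [Finset.card_image_of_injective _ (add_right_injective a)] at h2
  have h3 := Finset.pred_card_le_card_erase (s := B) (a := a)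
  omega

theorem rs_main (n : ℕ) : ∀ A B : Finset ℤ, A.card + B.card = n → A.Nonempty → B.Nonempty →
    A.card + B.card ≤ (restrictedSumset A B).card + 3 := by
  induction n using Nat.strong_induction_on with
  | _ n ih =>
  intro A B hn hA hB
  have hA0 := hA.card_pos
  have hB0 := hB.card_pos
  by_cases hA1 : A.card = 1
  · exact rs_single A B hA1
  by_cases hB1 : B.card = 1
  · rw [rs_comm, add_comm]; exact rs_single B A hB1
  obtain ⟨a, ha, hamax⟩ : ∃ a ∈ A, ∀ x ∈ A, x ≤ a := ⟨A.max' hA, A.max'_mem hA, A.le_max'⟩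
  obtain ⟨b, hb, hbmax⟩ : ∃ a ∈ B, ∀ x ∈ B, x ≤ a := ⟨B.max' hB, B.max'_mem hB, B.le_max'⟩
  have cA := Finset.card_erase_of_mem ha
  have cB := Finset.card_erase_of_mem hb
  have neA : (A.erase a).Nonempty := Finset.card_pos.1 (by omega)
  have neB : (B.erase b).Nonempty := Finset.card_pos.1 (by omega)
  by_cases hab : a = b
  · subst hab
    have hi := ih _ (by omega) (A.erase a) (B.erase a) rfl neA neB
    obtain ⟨c, hc, hcmax⟩ : ∃ c ∈ A.erase a ∪ B.erase a, ∀ x ∈ A.erase a ∪ B.erase a, x ≤ c :=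
      ⟨_, Finset.max'_mem _ (neA.mono Finset.subset_union_left), Finset.le_max' _⟩
    have key : ∀ x ∈ A.erase a ∪ B.erase a, x < a ∧ a + x ∈ restrictedSumset A B := by
      intro x hx
      rw [mem_rs]
      rcases Finset.mem_union.1 hx with h | h <;> obtain ⟨h1, h2⟩ := Finset.mem_erase.1 h
      · exact ⟨lt_of_le_of_ne (hamax x h2) h1, x, h2, a, hb, h1, by omega⟩
      · exact ⟨lt_of_le_of_ne (hbmax x h2) h1, a, ha, x, h2, h1.symm, rfl⟩
    by_cases hne : ((A.erase a ∪ B.erase a).erase c).Nonempty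
    · obtain ⟨d, hd, hdmax⟩ : ∃ d ∈ (A.erase a ∪ B.erase a).erase c,
          ∀ x ∈ (A.erase a ∪ B.erase a).erase c, x ≤ d :=
        ⟨_, Finset.max'_mem _ hne, Finset.le_max' _⟩
      obtain ⟨hdc, hd'⟩ := Finset.mem_erase.1 hd
      have hdc' := hcmax d hd'
      have hbd : ∀ s ∈ restrictedSumset (A.erase a) (B.erase a), s ≤ c + d := by
        intro s hs
        obtain ⟨x, hx, y, hy, hxy, rfl⟩ := (mem_rs _ _ _).1 hs
        have hx' := Finset.mem_union_left (B.erase a) hx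
        have hy' := Finset.mem_union_right (A.erase a) hy
        have := hcmax x hx'
        have := hcmax y hy'
        by_cases hxc : x = c
        · have := hdmax y (Finset.mem_erase.2 ⟨by omega, hy'⟩)
          omega
        · have := hdmax x (Finset.mem_erase.2 ⟨hxc, hx'⟩)
          omega
      have k1 := key c hc
      have k2 := key d hd'
      have n2 : a + d ∉ restrictedSumset (A.erase a) (B.erase a) := fun h => by
        have := hbd _ h
        omega
      have n1 : a + c ∉ insert (a + d) (restrictedSumset (A.erase a) (B.erase a)) := fun h => by
        rcases Finset.mem_insert.1 h with h | h
        · omega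
        · have := hbd _ h
          omega
      have hsub : insert (a + c) (insert (a + d) (restrictedSumset (A.erase a) (B.erase a)))
          ⊆ restrictedSumset A B := by
        intro s hs
        rcases Finset.mem_insert.1 hs with rfl | hs
        · exact k1.2
        rcases Finset.mem_insert.1 hs with rfl | hs
        · exact k2.2
        obtain ⟨x, hx, y, hy, h⟩ := (mem_rs _ _ _).1 hs
        exact (mem_rs _ _ _).2 ⟨x, Finset.mem_of_mem_erase hx, y, Finset.mem_of_mem_erase hy, h⟩
      have := Finset.card_le_card hsub
      rw [Finset.card_insert_of_notMem n1, Finset.card_insert_of_notMem n2] at this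
      omega
    · have h0 := Finset.card_erase_of_mem hc
      rw [Finset.not_nonempty_iff_eq_empty.1 hne, Finset.card_empty] at h0
      have h1 := Finset.card_le_card (Finset.subset_union_left (s₁ := A.erase a) (s₂ := B.erase a))
      have h2 := Finset.card_le_card (Finset.subset_union_right (s₁ := A.erase a) (s₂ := B.erase a))
      have h3 := Finset.card_pos.2 ⟨_, (key c hc).2⟩
      omega
  · have hi := ih _ (by omega) (A.erase a) B rfl neA hB
    have n1 : a + b ∉ restrictedSumset (A.erase a) B := fun h => by
      obtain ⟨x, hx, y, hy, hxy, hs⟩ := (mem_rs _ _ _).1 h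
      obtain ⟨h1, h2⟩ := Finset.mem_erase.1 hx
      have := hamax x h2
      have := hbmax y hy
      omega
    have hsub : insert (a + b) (restrictedSumset (A.erase a) B) ⊆ restrictedSumset A B := by
      intro s hs
      rcases Finset.mem_insert.1 hs with rfl | hs
      · exact (mem_rs _ _ _).2 ⟨a, ha, b, hb, hab, rfl⟩
      obtain ⟨x, hx, y, hy, h⟩ := (mem_rs _ _ _).1 hs
      exact (mem_rs _ _ _).2 ⟨x, Finset.mem_of_mem_erase hx, y, hy, h⟩
    have := Finset.card_le_card hsub
    rw [Finset.card_insert_of_notMem n1] at this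
    omega

theorem stmt_5 (A B : Finset ℤ) (hA : 2 ≤ A.card) (hB : 2 ≤ B.card) :
    A.card + B.card - 3 ≤ (restrictedSumset A B).card := by
  have := rs_main _ A B rfl (Finset.card_pos.1 (by omega)) (Finset.card_pos.1 (by omega))
  omega
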